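/- arXiv:cs/0703129 — 2 statements merged into one kernel-verified Lean document; each statement's English description precedes it below -/
import Mathlib

section
/- (McEliece Formula) Let q be prime and let n, k, N be positive integers with q^k = 1 + nN. Let α generate F_{q^k}^*, let d = gcd(N, (q^k − 1)/(q − 1)), and let χ̄ be the multiplicative character of F_{q^k} of order d determined by χ̄(α) = exp(2πi/d). For ξ ∈ F_{q^k}^*, let w(ξ) denote the Hamming weight of the codeword (Tr(ξ), Tr(ξα^N), …, Tr(ξα^{(n−1)N})) of the associated irreducible cyclic code. Then w(ξ) = q^k(q−1)/(qN) − ((q−1)/(qN)) · Σ_{a=1}^{d−1} χ̄(ξ)^{−a} G(χ̄^a, e_1), where G(χ̄^a, e_1) = Σ_{x ∈ F_{q^k}^*} χ̄^a(x) e_1(x) is the Gauss sum of χ̄^a with the canonical additive character. -/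
/-- The fibres of a homomorphism of finite groups all have the same size, so averaging over the
source is the same as averaging over the range. -/
lemma MonoidHom.sum_comp_mul_card_range {G K : Type*} [Group G] [Group K] [Fintype G] [Fintype K]
    (φ : G →* K) [DecidablePred (· ∈ φ.range)] (F : K → ℂ) :
    (∑ g, F (φ g)) * Nat.card φ.range = Nat.card G * ∑ h with h ∈ φ.range, F h := by
  classical
  have hmaps : ∀ g ∈ (Finset.univ : Finset G),
      φ g ∈ Finset.univ.filter (· ∈ φ.range) := fun g _ ↦ by simp
  have hfib : ∀ h ∈ Finset.univ.filter (· ∈ φ.range),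
      ((Finset.univ : Finset G).filter (φ · = h)).card
        = ((Finset.univ : Finset G).filter (φ · = 1)).card := fun h hh ↦
    MonoidHom.card_fiber_eq_of_mem_range φ (by simpa using hh) ⟨1, map_one φ⟩
  have hrange : (Finset.univ.filter (· ∈ φ.range)).card = Nat.card φ.range := by
    rw [Nat.card_eq_fintype_card, Fintype.card_subtype]
  have hcard : Nat.card G
      = Nat.card φ.range * ((Finset.univ : Finset G).filter (φ · = 1)).card := by
    rw [Nat.card_eq_fintype_card, ← Finset.card_univ, Finset.card_eq_sum_card_fiberwise hmaps,
      Finset.sum_congr rfl hfib, Finset.sum_const, hrange, smul_eq_mul]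
  have hsum : ∑ g, F (φ g) = ((Finset.univ : Finset G).filter (φ · = 1)).card *
      ∑ h with h ∈ φ.range, F h := by
    rw [← Finset.sum_fiberwise_of_maps_to hmaps, Finset.mul_sum]
    refine Finset.sum_congr rfl fun h hh ↦ ?_
    rw [Finset.sum_congr rfl fun g hg ↦ by rw [(Finset.mem_filter.1 hg).2], Finset.sum_const,
      hfib h hh, nsmul_eq_mul]
  rw [hsum, hcard]
  push_cast
  ring

/-- Summing over all `N`-th powers in a cyclic group of order `n * N` is `N` times summing over
the subgroup of order `n`. -/
lemma sum_pow_of_generator {G : Type*} [CommGroup G] [Fintype G] {g : G}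
    (hg : ∀ x, x ∈ Subgroup.zpowers g) {n N : ℕ} (hn : 0 < n) (hN : 0 < N)
    (hcard : Nat.card G = n * N) (F : G → ℂ) :
    ∑ u : G, F (u ^ N) = N * ∑ i : Fin n, F (g ^ (N * (i : ℕ))) := by
  classical
  have hrange : (powMonoidHom N : G →* G).range = Subgroup.zpowers (g ^ N) := by
    apply le_antisymm
    · rintro _ ⟨u, rfl⟩
      obtain ⟨m, rfl⟩ := hg u
      exact ⟨m, by simp [← zpow_natCast, ← zpow_mul, mul_comm]⟩
    · rw [Subgroup.zpowers_le]
      exact ⟨g, rfl⟩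
  have hord : orderOf (g ^ N) = n := by
    have h : orderOf g = n * N := hcard ▸ orderOf_eq_card_of_forall_mem_zpowers hg
    rw [orderOf_pow_of_dvd hN.ne' (h ▸ dvd_mul_left N n), h, Nat.mul_div_cancel _ hN]
  have h := (powMonoidHom N : G →* G).sum_comp_mul_card_range F
  have hsub : ∑ h with h ∈ (powMonoidHom N : G →* G).range, F h
      = ∑ i : Fin n, F (g ^ (N * (i : ℕ))) := by
    subst hord
    have h2 : ∑ h with h ∈ (powMonoidHom N : G →* G).range, F h
        = ∑ h : Subgroup.zpowers (g ^ N), F h := by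
      apply Finset.sum_subtype
      simp [hrange]
    rw [h2, ← (finEquivZPowers (isOfFinOrder_of_finite (g ^ N))).sum_comp]
    exact Finset.sum_congr rfl fun i _ ↦ by rw [finEquivZPowers_apply, pow_mul]
  rw [hsub, hrange, Nat.card_zpowers, hord, hcard] at h
  simp only [powMonoidHom_apply] at h
  have hn' : (n : ℂ) ≠ 0 := by exact_mod_cast hn.ne'
  apply mul_right_cancel₀ hn'
  rw [h]
  push_cast
  ring

lemma zpowers_pow_gcd_eq_range {G B : Type*} [CommGroup G] [CommGroup B] {g : G}
    (hg : ∀ x, x ∈ Subgroup.zpowers g) (N M : ℕ) (f : B →* G)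
    (hf : f.range = Subgroup.zpowers (g ^ M)) :
    ((powMonoidHom N : G →* G).coprod f).range = Subgroup.zpowers (g ^ Nat.gcd N M) := by
  apply le_antisymm
  · rintro _ ⟨⟨u, b⟩, rfl⟩
    rw [MonoidHom.coprod_apply]
    refine mul_mem ?_ ?_
    · obtain ⟨m, rfl⟩ := hg u
      obtain ⟨c, hc⟩ := Nat.gcd_dvd_left N M
      refine ⟨c * m, ?_⟩
      simp only [powMonoidHom_apply, ← zpow_natCast, ← zpow_mul]
      congr 1
      conv_rhs => rw [hc]
      push_cast
      ring
    · have hb : f b ∈ Subgroup.zpowers (g ^ M) := hf ▸ ⟨b, rfl⟩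
      obtain ⟨c, hc⟩ := Nat.gcd_dvd_right N M
      refine (Subgroup.zpowers_le.2 ?_) hb
      refine ⟨c, ?_⟩
      conv_rhs => rw [hc]
      simp [pow_mul]
  · rw [Subgroup.zpowers_le]
    have hb : (g ^ M) ^ Nat.gcdB N M ∈ f.range := hf ▸ ⟨_, rfl⟩
    obtain ⟨b, hb⟩ := hb
    refine ⟨(g ^ Nat.gcdA N M, b), ?_⟩
    rw [MonoidHom.coprod_apply, hb, powMonoidHom_apply]
    simp only [← zpow_natCast, ← zpow_mul, ← zpow_add]
    congr 1
    rw [Nat.gcd_eq_gcd_ab]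
    ring

/-- Orthogonality of the powers of a primitive root of unity. -/
lemma IsPrimitiveRoot.sum_pow_pow {ζ : ℂ} {d : ℕ} (hζ : IsPrimitiveRoot ζ d) (m : ℕ) :
    ∑ a ∈ Finset.range d, (ζ ^ m) ^ a = if d ∣ m then (d : ℂ) else 0 := by
  split_ifs with h
  · simp [(hζ.pow_eq_one_iff_dvd m).2 h]
  · rw [geom_sum_eq (fun h' ↦ h ((hζ.pow_eq_one_iff_dvd m).1 h')), ← pow_mul, mul_comm m, pow_mul,
      hζ.pow_eq_one, one_pow, sub_self, zero_div]

/-- The number of nonzero entries of a vector over `ZMod q`, via additive characters. -/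
lemma card_mul_hammingNorm {q n : ℕ} [Fact q.Prime] (v : Fin n → ZMod q) :
    (q : ℂ) * hammingNorm v = n * ((q : ℂ) - 1)
      - ∑ i, ∑ y : (ZMod q)ˣ, ZMod.stdAddChar ((y : ZMod q) * v i) := by
  have key (z : ZMod q) : (q : ℂ) * (if z ≠ 0 then 1 else 0) = ((q : ℂ) - 1)
      - ∑ y : (ZMod q)ˣ, ZMod.stdAddChar ((y : ZMod q) * z) := by
    have h := AddChar.sum_mulShift z (ZMod.isPrimitive_stdAddChar q)
    rw [ZMod.card] at h
    rw [← Finset.add_sum_erase _ _ (Finset.mem_univ 0)] at h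
    have h2 : ∑ y : (ZMod q)ˣ, ZMod.stdAddChar ((y : ZMod q) * z)
        = ∑ y ∈ Finset.univ.erase (0 : ZMod q), ZMod.stdAddChar (y * z) := by
      refine Finset.sum_bij (fun y _ ↦ (y : ZMod q)) (by simp) (by simp [Units.ext_iff]) ?_ (by simp)
      intro b hb
      exact ⟨Units.mk0 b (by simpa using hb), by simp, rfl⟩
    rw [← h2, zero_mul, AddChar.map_zero_eq_one] at h
    by_cases hz : z = 0
    · simp [hz, ZMod.card_units_eq_totient,
        Nat.totient_prime (Fact.out : q.Prime), (Fact.out : q.Prime).one_le]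
    · simp only [hz, if_false, ne_eq, not_false_eq_true, if_true] at h ⊢
      push_cast at h
      linear_combination h
  have hw : (hammingNorm v : ℂ) = ∑ i, if v i ≠ 0 then 1 else 0 := by
    rw [hammingNorm, Finset.card_filter]
    push_cast
    rfl
  rw [hw, Finset.mul_sum, Finset.sum_congr rfl fun i _ ↦ key (v i), Finset.sum_sub_distrib]
  simp
  ring

/-- The units of the prime subfield are the powers of `g ^ ((q ^ k - 1) / (q - 1))`, where `g`
generates the unit group. -/
lemma range_units_map_algebraMap {q k : ℕ} [Fact q.Prime] (hk : 0 < k) {E : Type*} [Field E]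
    [Fintype E] [Algebra (ZMod q) E] (hE : Fintype.card E = q ^ k) {g : Eˣ}
    (hg : ∀ x, x ∈ Subgroup.zpowers g) :
    (Units.map (algebraMap (ZMod q) E : ZMod q →* E)).range
      = Subgroup.zpowers (g ^ ((q ^ k - 1) / (q - 1))) := by
  have hq : q.Prime := Fact.out
  have hfin : Module.finrank (ZMod q) E = k := by
    have h := Module.card_eq_pow_finrank (K := ZMod q) (V := E)
    rw [hE, ZMod.card] at h
    exact (Nat.pow_right_injective hq.two_le h).symm
  have hdvd : q - 1 ∣ q ^ k - 1 := by simpa using Nat.sub_dvd_pow_sub_pow q 1 k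
  have hord : orderOf g = q ^ k - 1 := by
    rw [orderOf_eq_card_of_forall_mem_zpowers hg, Nat.card_units, Nat.card_eq_fintype_card, hE]
  have hpos : 0 < q ^ k - 1 := by
    have := Nat.one_lt_pow hk.ne' hq.one_lt
    omega
  have hle : Subgroup.zpowers (g ^ ((q ^ k - 1) / (q - 1)))
      ≤ (Units.map (algebraMap (ZMod q) E : ZMod q →* E)).range := by
    rw [Subgroup.zpowers_le]
    have h := FiniteField.algebraMap_norm_eq_pow_sum (ZMod q) E (g : E)
    rw [hfin, Nat.card_zmod, Nat.geomSum_eq hq.two_le] at h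
    refine ⟨Units.mk0 (Algebra.norm (ZMod q) (g : E)) ?_, ?_⟩
    · rw [Ne, ← (algebraMap (ZMod q) E).injective.eq_iff, h, map_zero]
      simp
    · ext
      simpa using h
  refine (Subgroup.eq_of_le_of_card_ge hle ?_).symm
  have hM : (q ^ k - 1) / (q - 1) ≠ 0 :=
    (Nat.div_pos (Nat.le_of_dvd hpos hdvd) (by have := hq.one_lt; omega)).ne'
  rw [Nat.card_zpowers, orderOf_pow_of_dvd hM (by rw [hord]; exact Nat.div_dvd_of_dvd hdvd), hord,
    Nat.div_div_self hdvd hpos.ne']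
  calc Nat.card (Units.map (algebraMap (ZMod q) E : ZMod q →* E)).range
      ≤ Nat.card (ZMod q)ˣ := Nat.card_le_card_of_surjective _
        (Units.map (algebraMap (ZMod q) E : ZMod q →* E)).rangeRestrict_surjective
    _ = q - 1 := by
      rw [Nat.card_eq_fintype_card, ZMod.card_units_eq_totient, Nat.totient_prime hq]

/-- A function satisfying the power-sum formula for the trace of `F_{q^k}` is the trace. -/
lemma eq_trace_of_algebraMap_eq_sum_pow {q k : ℕ} [Fact q.Prime] {E : Type*} [Field E]
    [Fintype E] [Algebra (ZMod q) E] (hE : Fintype.card E = q ^ k) {tr : E → ZMod q}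
    (htr : ∀ ξ : E, algebraMap (ZMod q) E (tr ξ) = ∑ j ∈ Finset.range k, ξ ^ q ^ j) (x : E) :
    tr x = Algebra.trace (ZMod q) E x := by
  have hq : q.Prime := Fact.out
  have hfin : Module.finrank (ZMod q) E = k := by
    have h := Module.card_eq_pow_finrank (K := ZMod q) (V := E)
    rw [hE, ZMod.card] at h
    exact (Nat.pow_right_injective hq.two_le h).symm
  apply (algebraMap (ZMod q) E).injective
  rw [htr, FiniteField.algebraMap_trace_eq_sum_pow, hfin, Nat.card_zmod]

lemma sum_units_stdAddChar_trace {q : ℕ} [Fact q.Prime] {E : Type*} [Field E]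
    [Fintype E] [DecidableEq E] [Algebra (ZMod q) E] :
    ∑ x : Eˣ, ZMod.stdAddChar (Algebra.trace (ZMod q) E x) = -1 := by
  have : FiniteDimensional (ZMod q) E := Module.Finite.of_finite
  let ψ : AddChar E ℂ :=
    ZMod.stdAddChar.compAddMonoidHom (Algebra.trace (ZMod q) E).toAddMonoidHom
  have hψ : ψ ≠ 1 := by
    intro h
    obtain ⟨x, hx⟩ := Algebra.trace_surjective (ZMod q) E 1
    have h1 : ψ x = 1 := by rw [h]; rfl
    have h2 : ZMod.stdAddChar (1 : ZMod q) = ZMod.stdAddChar (0 : ZMod q) := by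
      rw [AddChar.map_zero_eq_one, ← hx]
      exact h1
    exact one_ne_zero (ZMod.injective_stdAddChar h2)
  have h := AddChar.sum_eq_zero_of_ne_one hψ
  rw [← Finset.add_sum_erase _ _ (Finset.mem_univ 0), AddChar.map_zero_eq_one] at h
  have h2 : ∑ x : Eˣ, ψ x = ∑ x ∈ Finset.univ.erase (0 : E), ψ x := by
    refine Finset.sum_bij (fun y _ ↦ (y : E)) (by simp) (by simp [Units.ext_iff]) ?_ (by simp)
    intro b hb
    exact ⟨Units.mk0 b (by simpa using hb), by simp, rfl⟩
  change ∑ x : Eˣ, ψ x = -1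
  rw [h2]
  linear_combination h

/-- McEliece's formula, with the Gauss sums taken over the unit group. -/
lemma hammingNorm_eq_sum_units {q k n N d : ℕ} [Fact q.Prime] (hk : 0 < k) (hn : 0 < n)
    (hN : 0 < N) {E : Type*} [Field E] [Fintype E] [DecidableEq E] [Algebra (ZMod q) E]
    (hE : Fintype.card E = q ^ k) (hnN : q ^ k = 1 + n * N) {g : Eˣ}
    (hg : ∀ x, x ∈ Subgroup.zpowers g) (hd : d = Nat.gcd N ((q ^ k - 1) / (q - 1)))
    {ζ : ℂ} (hζ : IsPrimitiveRoot ζ d) {χ : E → ℂ} (hχ : ∀ m : ℕ, χ ((g : E) ^ m) = ζ ^ m)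
    (ξ : Eˣ) :
    (hammingNorm (fun i : Fin n =>
        Algebra.trace (ZMod q) E (ξ * (g : E) ^ (N * (i : ℕ)))) : ℂ)
      = (q : ℂ) ^ k * ((q : ℂ) - 1) / ((q : ℂ) * N)
        - ((q : ℂ) - 1) / ((q : ℂ) * N) *
            ∑ a ∈ Finset.Icc 1 (d - 1), (χ ξ)⁻¹ ^ a *
              ∑ x : Eˣ, χ x ^ a * ZMod.stdAddChar (Algebra.trace (ZMod q) E x) := by
  have hq : q.Prime := Fact.out
  have hd0 : 0 < d := hd ▸ Nat.gcd_pos_of_pos_left _ hN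
  have hdN : d ∣ N := hd ▸ Nat.gcd_dvd_left _ _
  have hcard : Nat.card Eˣ = n * N := by
    rw [Nat.card_units, Nat.card_eq_fintype_card, hE, hnN]
    omega
  have hord : orderOf g = n * N := by
    rw [orderOf_eq_card_of_forall_mem_zpowers hg, hcard]
  have hpow (x : Eˣ) : ∃ m : ℕ, g ^ m = x := by
    obtain ⟨m, hm⟩ := mem_powers_iff_mem_zpowers.2 (hg x)
    exact ⟨m, hm⟩
  have hχu (m : ℕ) : χ ((g ^ m : Eˣ) : E) = ζ ^ m := by rw [Units.val_pow_eq_pow_val, hχ]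
  have hζ0 : ζ ≠ 0 := hζ.ne_zero hd0.ne'
  set Ψ : Eˣ → ℂ := fun x ↦ ZMod.stdAddChar (Algebra.trace (ZMod q) E x) with hΨ
  set H := Subgroup.zpowers (g ^ d) with hH
  have : DecidablePred (· ∈ H) := Classical.decPred _
  have hmem (m : ℕ) : g ^ m ∈ H ↔ d ∣ m := by
    constructor
    · intro h
      obtain ⟨j, hj⟩ := mem_powers_iff_mem_zpowers.2 h
      have hj' : g ^ (d * j) = g ^ m := by rw [pow_mul]; exact hj
      rw [pow_eq_pow_iff_modEq, hord] at hj'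
      have := hj'.of_dvd (hdN.mul_left n)
      exact (this.dvd_iff dvd_rfl).1 (dvd_mul_right d j)
    · rintro ⟨j, rfl⟩
      exact ⟨j, by simp [pow_mul]⟩
  have hHcard : Nat.card H * d = n * N := by
    rw [hH, Nat.card_zpowers, orderOf_pow_of_dvd hd0.ne' (hord ▸ hdN.mul_left n), hord,
      Nat.div_mul_cancel (hdN.mul_left n)]
  have hgauss : ∑ a ∈ Finset.range d, (χ ξ)⁻¹ ^ a * ∑ x : Eˣ, χ x ^ a * Ψ x
      = d * ∑ h with h ∈ H, Ψ (ξ * h) := by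
    obtain ⟨s, hs⟩ := hpow ξ
    have hshift (a : ℕ) : (χ ξ)⁻¹ ^ a * ∑ x : Eˣ, χ x ^ a * Ψ x
        = ∑ h : Eˣ, χ h ^ a * Ψ (ξ * h) := by
      rw [← Equiv.sum_comp (Equiv.mulLeft ξ), Finset.mul_sum]
      refine Finset.sum_congr rfl fun h _ ↦ ?_
      obtain ⟨m, rfl⟩ := hpow h
      simp only [Equiv.coe_mulLeft]
      rw [← hs, ← pow_add, hχu, hχu, hχu, pow_add ζ, mul_pow, ← mul_assoc, ← mul_assoc, inv_pow,
        inv_mul_cancel₀ (pow_ne_zero _ (pow_ne_zero _ hζ0)), one_mul]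
    rw [Finset.sum_congr rfl fun a _ ↦ hshift a, Finset.sum_comm, Finset.sum_filter, Finset.mul_sum]
    refine Finset.sum_congr rfl fun h _ ↦ ?_
    obtain ⟨m, rfl⟩ := hpow h
    rw [← Finset.sum_mul, hχu, hζ.sum_pow_pow]
    simp only [hmem]
    split_ifs <;> simp
  have hsplit : ∑ a ∈ Finset.range d, (χ ξ)⁻¹ ^ a * ∑ x : Eˣ, χ x ^ a * Ψ x
      = -1 + ∑ a ∈ Finset.Icc 1 (d - 1), (χ ξ)⁻¹ ^ a * ∑ x : Eˣ, χ x ^ a * Ψ x := by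
    rw [Finset.range_eq_Ico, Finset.sum_eq_sum_Ico_succ_bot hd0]
    congr 1
    simpa using sum_units_stdAddChar_trace (q := q) (E := E)
  have hcount : (∑ p : Eˣ × (ZMod q)ˣ, Ψ (ξ * (p.1 ^ N *
        Units.map (algebraMap (ZMod q) E : ZMod q →* E) p.2)))
      = d * ((q : ℂ) - 1) * ∑ h with h ∈ H, Ψ (ξ * h) := by
    have hr := zpowers_pow_gcd_eq_range hg N ((q ^ k - 1) / (q - 1)) _
      (range_units_map_algebraMap hk hE hg)
    rw [← hd, ← hH] at hr
    have h := MonoidHom.sum_comp_mul_card_range ((powMonoidHom N : Eˣ →* Eˣ).coprod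
      (Units.map (algebraMap (ZMod q) E : ZMod q →* E))) (fun x ↦ Ψ (ξ * x))
    have hU : (Nat.card (ZMod q)ˣ : ℂ) = (q : ℂ) - 1 := by
      rw [Nat.card_eq_fintype_card, ZMod.card_units_eq_totient, Nat.totient_prime hq,
        Nat.cast_sub hq.one_le, Nat.cast_one]
    simp only [MonoidHom.coprod_apply, powMonoidHom_apply, hr, Nat.card_prod, hcard] at h
    rw [← hHcard] at h
    have hH0 : (Nat.card H : ℂ) ≠ 0 := by exact_mod_cast Nat.card_pos.ne'
    apply mul_right_cancel₀ hH0
    rw [h]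
    push_cast
    rw [hU]
    ring
  have hinner : (N : ℂ) * ∑ i : Fin n, ∑ y : (ZMod q)ˣ, ZMod.stdAddChar ((y : ZMod q) *
        Algebra.trace (ZMod q) E (ξ * (g : E) ^ (N * (i : ℕ))))
      = ∑ p : Eˣ × (ZMod q)ˣ, Ψ (ξ * (p.1 ^ N *
        Units.map (algebraMap (ZMod q) E : ZMod q →* E) p.2)) := by
    rw [Fintype.sum_prod_type]
    rw [sum_pow_of_generator hg hn hN hcard (fun u ↦ ∑ y : (ZMod q)ˣ, Ψ (ξ * (u *
        Units.map (algebraMap (ZMod q) E : ZMod q →* E) y)))]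
    congr 1
    refine Finset.sum_congr rfl fun i _ ↦ Finset.sum_congr rfl fun y _ ↦ ?_
    rw [hΨ, ← smul_eq_mul (y : ZMod q), ← map_smul, Algebra.smul_def]
    simp only [Units.val_mul, Units.val_pow_eq_pow_val, Units.coe_map, MonoidHom.coe_coe]
    congr 2
    ring
  have hw := card_mul_hammingNorm (q := q)
    (fun i : Fin n => Algebra.trace (ZMod q) E (ξ * (g : E) ^ (N * (i : ℕ))))
  have hq0 : (q : ℂ) ≠ 0 := by exact_mod_cast hq.ne_zero
  have hN0 : (N : ℂ) ≠ 0 := by exact_mod_cast hN.ne'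
  have hqk : (q : ℂ) ^ k = 1 + n * N := by exact_mod_cast hnN
  rw [hqk, div_mul_eq_mul_div, ← sub_div, eq_div_iff (mul_ne_zero hq0 hN0)]
  linear_combination (N : ℂ) * hw - hinner - hcount + ((q : ℂ) - 1) * (hgauss - hsplit)


/-- McEliece Formula: Let `q` be prime, `q^k = 1 + nN`, `α` a generator of
`F_{q^k}^*`, `d = gcd(N, (q^k - 1)/(q - 1))`, and `χ̄` the multiplicative character of order `d`
with `χ̄(α^m) = exp(2πi m/d)`. For `ξ ≠ 0`, the Hamming weight of the codeword
`(Tr ξ, Tr(ξα^N), …, Tr(ξα^{(n-1)N}))` satisfies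
`w(ξ) = q^k(q-1)/(qN) - ((q-1)/(qN)) Σ_{a=1}^{d-1} χ̄(ξ)^{-a} G(χ̄^a, e_1)`, where
`G(χ̄^a, e_1) = Σ_{x ≠ 0} χ̄(x)^a · exp(2πi Tr(x)/q)` is a Gauss sum. -/
theorem stmt_5 (q k n N : ℕ) (hq : q.Prime) [Fact q.Prime]
    (hk : 0 < k) (hn : 0 < n) (hN : 0 < N)
    (E : Type*) [Field E] [Fintype E] [DecidableEq E] [Algebra (ZMod q) E]
    (hE : Fintype.card E = q ^ k)
    (hnN : q ^ k = 1 + n * N)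
    (α : E) (hα : ∀ x : E, x ≠ 0 → ∃ m : ℕ, α ^ m = x)
    (tr : E → ZMod q)
    (htr : ∀ ξ : E, algebraMap (ZMod q) E (tr ξ) = ∑ j ∈ Finset.range k, ξ ^ q ^ j)
    (d : ℕ) (hd : d = Nat.gcd N ((q ^ k - 1) / (q - 1)))
    (χ : E → ℂ)
    (hχ : ∀ m : ℕ, χ (α ^ m) = Complex.exp (2 * Real.pi * Complex.I * m / d))
    (ξ : E) (hξ : ξ ≠ 0) :
    (hammingNorm (fun i : Fin n => tr (ξ * α ^ (N * (i : ℕ)))) : ℂ)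
      = (q : ℂ) ^ k * ((q : ℂ) - 1) / ((q : ℂ) * N)
        - ((q : ℂ) - 1) / ((q : ℂ) * N) *
            ∑ a ∈ Finset.Icc 1 (d - 1),
              (χ ξ)⁻¹ ^ a *
                ∑ x ∈ Finset.univ.filter (fun x : E => x ≠ 0),
                  χ x ^ a * Complex.exp (2 * Real.pi * Complex.I * ((tr x).val : ℂ) / q) := by
  have htr' := eq_trace_of_algebraMap_eq_sum_pow hE htr
  by_cases hα0 : α = 0
  · -- a generating `0` means that `E` has no units besides `1`
    have h1 (x : E) (hx : x ≠ 0) : x = 1 := by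
      obtain ⟨m, rfl⟩ := hα x hx
      have hm : m = 0 := by
        by_contra hm
        exact hx (by rw [hα0, zero_pow hm])
      rw [hm, pow_zero]
    have hcard : Fintype.card E = 2 := by
      rw [← Finset.card_univ, show (Finset.univ : Finset E) = {0, 1} by
        ext x
        by_cases hx : x = 0
        · simp [hx]
        · simp [h1 x hx]]
      simp
    have hqk : q ^ k = 2 := hE ▸ hcard
    have hk1 : k = 1 := (Nat.Prime.eq_one_of_pow (n := k) (hqk ▸ Nat.prime_two))
    subst hk1
    have hq2 : q = 2 := by simpa using hqk
    subst hq2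
    have hnN1 : n * N = 1 := by omega
    obtain ⟨rfl, rfl⟩ := mul_eq_one.1 hnN1
    have htr1 : tr ξ ≠ 0 := by
      intro h
      have := htr ξ
      simp [h] at this
      exact hξ this.symm
    have hd1 : d = 1 := by rw [hd, Nat.gcd_one_left]
    subst hd1
    simp [hammingNorm, htr1]
    norm_num
  · let g : Eˣ := Units.mk0 α hα0
    have hg (x : Eˣ) : x ∈ Subgroup.zpowers g := by
      obtain ⟨m, hm⟩ := hα x x.ne_zero
      refine ⟨m, ?_⟩
      ext
      simpa [g] using hm
    have hd0 : d ≠ 0 := hd ▸ (Nat.gcd_pos_of_pos_left _ hN).ne'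
    have hχ' (m : ℕ) : χ ((g : E) ^ m) = Complex.exp (2 * Real.pi * Complex.I / d) ^ m := by
      rw [← Complex.exp_nat_mul]
      simp only [g, Units.val_mk0, hχ]
      congr 1
      ring
    have hexp (x : E) : Complex.exp (2 * Real.pi * Complex.I * ((tr x).val : ℂ) / q)
        = ZMod.stdAddChar (Algebra.trace (ZMod q) E x) := by
      rw [ZMod.stdAddChar_apply, ZMod.toCircle_apply, htr']
    have hsum (F : E → ℂ) : ∑ x ∈ Finset.univ.filter (fun x : E => x ≠ 0), F x
        = ∑ x : Eˣ, F x := by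
      symm
      refine Finset.sum_bij (fun y _ ↦ (y : E)) (by simp) (by simp [Units.ext_iff]) ?_ (by simp)
      intro b hb
      exact ⟨Units.mk0 b (by simpa using hb), by simp, rfl⟩
    have h := hammingNorm_eq_sum_units hk hn hN hE hnN hg hd (Complex.isPrimitiveRoot_exp d hd0)
      hχ' (Units.mk0 ξ hξ)
    simp only [hsum, hexp]
    simp only [htr']
    exact h
end

section
/- Let q and N be positive integers with q ≥ 2 and gcd(q, N) = 1. The number N_C of q-cyclotomic cosets modulo N (equivalently, the number of orbits of the map x ↦ q·x on Z/NZ) is N_C = Σ_{f | N} φ(f)/ord_f(q), where the sum is over the positive divisors f of N, φ is the Euler totient function, and ord_f(q) is the multiplicative order of q modulo f. -/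
/-- The `q`-cyclotomic coset of `a` modulo `N`. -/
def cyclotomicCoset (q N a : ℕ) : Finset ℕ :=
  Finset.image (fun j => a * q ^ j % N) (Finset.range N)

theorem orderOf_natCast_dvd_totient {q f : ℕ} (h : q.Coprime f) :
    orderOf (q : ZMod f) ∣ f.totient := by
  apply orderOf_dvd_of_pow_eq_one
  have := congrArg Units.val (ZMod.pow_totient (ZMod.unitOfCoprime q h))
  rwa [Units.val_pow_eq_pow_val, ZMod.coe_unitOfCoprime, Units.val_one] at this

theorem orderOf_natCast_pos {q f : ℕ} (hf : 0 < f) (h : q.Coprime f) :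
    0 < orderOf (q : ZMod f) :=
  Nat.pos_of_dvd_of_pos (orderOf_natCast_dvd_totient h) (Nat.totient_pos.2 hf)

theorem pow_modEq_pow_iff_modEq_orderOf {q f : ℕ} (h : q.Coprime f) (i j : ℕ) :
    q ^ i ≡ q ^ j [MOD f] ↔ i ≡ j [MOD orderOf (q : ZMod f)] := by
  rw [← ZMod.natCast_eq_natCast_iff, ← ZMod.coe_unitOfCoprime q h, orderOf_units,
    ← pow_eq_pow_iff_modEq, Units.ext_iff]
  simp

theorem mul_pow_modEq_mul_pow_iff {q N : ℕ} (hN : 0 < N) (h : q.Coprime N) (a i j : ℕ) :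
    a * q ^ i ≡ a * q ^ j [MOD N] ↔
      i ≡ j [MOD orderOf (q : ZMod (N / N.gcd a))] := by
  have hd : N / N.gcd a ∣ N := Nat.div_dvd_of_dvd (Nat.gcd_dvd_left N a)
  rw [← pow_modEq_pow_iff_modEq_orderOf (h.coprime_dvd_right hd)]
  refine ⟨fun H => H.cancel_left_div_gcd hN, fun H => ?_⟩
  have H2 := H.mul_left' (N.gcd a)
  rw [Nat.mul_div_cancel' (Nat.gcd_dvd_left N a)] at H2
  obtain ⟨b, hb⟩ := Nat.gcd_dvd_right N a
  have H3 := H2.mul_left b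
  convert H3 using 1 <;> (conv_lhs => rw [hb]) <;> ring

theorem orderOf_natCast_le {q N : ℕ} (hN : 0 < N) (h : q.Coprime N) {f : ℕ} (hf : f ∣ N) :
    orderOf (q : ZMod f) ≤ N :=
  have hf0 := Nat.pos_of_dvd_of_pos hf hN
  (Nat.le_of_dvd (Nat.totient_pos.2 hf0)
    (orderOf_natCast_dvd_totient (h.coprime_dvd_right hf))).trans
    ((Nat.totient_le f).trans (Nat.le_of_dvd hN hf))

theorem cyclotomicCoset_eq_image_range_orderOf {q N : ℕ} (hN : 0 < N) (h : q.Coprime N) (a : ℕ) :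
    cyclotomicCoset q N a = Finset.image (fun j => a * q ^ j % N)
      (Finset.range (orderOf (q : ZMod (N / N.gcd a)))) := by
  have hd : N / N.gcd a ∣ N := Nat.div_dvd_of_dvd (Nat.gcd_dvd_left N a)
  apply Finset.Subset.antisymm
  · intro c hc
    obtain ⟨j, -, rfl⟩ := Finset.mem_image.1 hc
    refine Finset.mem_image.2 ⟨j % orderOf (q : ZMod (N / N.gcd a)), Finset.mem_range.2
      (Nat.mod_lt _ (orderOf_natCast_pos (Nat.pos_of_dvd_of_pos hd hN)
        (h.coprime_dvd_right hd))), ?_⟩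
    exact (mul_pow_modEq_mul_pow_iff hN h a _ _).2 (Nat.mod_modEq _ _)
  · exact Finset.image_subset_image (Finset.range_mono (orderOf_natCast_le hN h hd))

theorem card_cyclotomicCoset {q N : ℕ} (hN : 0 < N) (h : q.Coprime N) (a : ℕ) :
    (cyclotomicCoset q N a).card = orderOf (q : ZMod (N / N.gcd a)) := by
  rw [cyclotomicCoset_eq_image_range_orderOf hN h, Finset.card_image_of_injOn,
    Finset.card_range]
  intro i hi j hj hij
  exact ((mul_pow_modEq_mul_pow_iff hN h a i j).1 hij).eq_of_lt_of_lt
    (Finset.mem_range.1 hi) (Finset.mem_range.1 hj)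

theorem mem_cyclotomicCoset {q N : ℕ} (hN : 0 < N) (h : q.Coprime N) {a c : ℕ} :
    c ∈ cyclotomicCoset q N a ↔ ∃ j, a * q ^ j % N = c := by
  refine ⟨fun hc => ?_, ?_⟩
  · obtain ⟨j, -, hj⟩ := Finset.mem_image.1 hc
    exact ⟨j, hj⟩
  · rintro ⟨j, rfl⟩
    refine Finset.mem_image.2 ⟨j % orderOf (q : ZMod N), Finset.mem_range.2
      ((Nat.mod_lt _ (orderOf_natCast_pos hN h)).trans_le
        (orderOf_natCast_le hN h dvd_rfl)), ?_⟩
    exact ((pow_modEq_pow_iff_modEq_orderOf h _ _).2 (Nat.mod_modEq _ _)).mul_left a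

theorem self_mem_cyclotomicCoset {q N a : ℕ} (ha : a < N) : a ∈ cyclotomicCoset q N a :=
  Finset.mem_image.2 ⟨0, Finset.mem_range.2 (by omega), by simp [Nat.mod_eq_of_lt ha]⟩

theorem cyclotomicCoset_subset {q N : ℕ} (hN : 0 < N) (h : q.Coprime N) {a b : ℕ}
    (hb : b ∈ cyclotomicCoset q N a) : cyclotomicCoset q N b ⊆ cyclotomicCoset q N a := by
  intro c hc
  obtain ⟨i, rfl⟩ := (mem_cyclotomicCoset hN h).1 hb
  obtain ⟨j, rfl⟩ := (mem_cyclotomicCoset hN h).1 hc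
  refine (mem_cyclotomicCoset hN h).2 ⟨i + j, ?_⟩
  rw [pow_add, ← mul_assoc, Nat.mod_mul_mod]

theorem gcd_eq_of_mem_cyclotomicCoset {q N : ℕ} (hN : 0 < N) (h : q.Coprime N) {a b : ℕ}
    (hb : b ∈ cyclotomicCoset q N a) : N.gcd b = N.gcd a := by
  obtain ⟨i, rfl⟩ := (mem_cyclotomicCoset hN h).1 hb
  rw [Nat.gcd_comm, ← Nat.gcd_rec, Nat.Coprime.gcd_mul_right_cancel_right a (h.pow_left i)]

theorem cyclotomicCoset_eq_of_mem {q N : ℕ} (hN : 0 < N) (h : q.Coprime N) {a b : ℕ}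
    (hb : b ∈ cyclotomicCoset q N a) : cyclotomicCoset q N b = cyclotomicCoset q N a := by
  apply Finset.eq_of_subset_of_card_le (cyclotomicCoset_subset hN h hb)
  rw [card_cyclotomicCoset hN h, card_cyclotomicCoset hN h, gcd_eq_of_mem_cyclotomicCoset hN h hb]

theorem filter_cyclotomicCoset_eq {q N : ℕ} (hN : 0 < N) (h : q.Coprime N) (a : ℕ) :
    (Finset.range N).filter (fun b => cyclotomicCoset q N b = cyclotomicCoset q N a) =
      cyclotomicCoset q N a := by
  ext b
  rw [Finset.mem_filter, Finset.mem_range]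
  refine ⟨fun ⟨hb, hba⟩ => hba ▸ self_mem_cyclotomicCoset hb, fun hb => ⟨?_,
    cyclotomicCoset_eq_of_mem hN h hb⟩⟩
  obtain ⟨j, rfl⟩ := (mem_cyclotomicCoset hN h).1 hb
  exact Nat.mod_lt _ hN

theorem card_image_cyclotomicCoset {q N : ℕ} (hN : 0 < N) (h : q.Coprime N) :
    (((Finset.range N).image (cyclotomicCoset q N)).card : ℚ) =
      ∑ a ∈ Finset.range N, (1 : ℚ) / (cyclotomicCoset q N a).card := by
  rw [Finset.card_eq_sum_ones, Nat.cast_sum]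
  refine Finset.sum_image' _ fun a ha => ?_
  rw [Finset.sum_congr rfl (g := fun _ => (1 : ℚ) / (cyclotomicCoset q N a).card)
    fun b hb => by rw [(Finset.mem_filter.1 hb).2], filter_cyclotomicCoset_eq hN h,
    Finset.sum_const, nsmul_eq_mul]
  have : ((cyclotomicCoset q N a).card : ℚ) ≠ 0 := Nat.cast_ne_zero.2
    (Finset.card_ne_zero_of_mem (self_mem_cyclotomicCoset (Finset.mem_range.1 ha)))
  field_simp
  simp

/-- For `q ≥ 2` and `N ≥ 1` with `gcd(q, N) = 1`, the number of `q`-cyclotomic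
cosets modulo `N` (the orbits `{a·q^j mod N : j ≥ 0}` of the map `x ↦ q·x` on `Z/NZ`) equals
`Σ_{f | N} φ(f) / ord_f(q)`, where `φ` is the Euler totient and `ord_f(q)` is the
multiplicative order of `q` modulo `f`. -/
theorem stmt_9 (q N : ℕ) (hq : 2 ≤ q) (hN : 0 < N) (hcop : Nat.gcd q N = 1) :
    (Finset.image (fun a => Finset.image (fun j => a * q ^ j % N) (Finset.range N))
        (Finset.range N)).card
      = ∑ f ∈ N.divisors, Nat.totient f / orderOf (q : ZMod f) := by
  have h : q.Coprime N := hcop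
  change ((Finset.range N).image (cyclotomicCoset q N)).card = _
  rw [← Nat.cast_inj (R := ℚ), card_image_cyclotomicCoset hN h, ← Nat.sum_div_divisors,
    Nat.cast_sum, ← Finset.sum_fiberwise_of_maps_to (g := N.gcd) (t := N.divisors)
      fun a _ => Nat.mem_divisors.2 ⟨Nat.gcd_dvd_left N a, hN.ne'⟩]
  refine Finset.sum_congr rfl fun d hd => ?_
  have hdN := Nat.dvd_of_mem_divisors hd
  have hf : N / d ∣ N := Nat.div_dvd_of_dvd hdN
  have hcf := h.coprime_dvd_right hf
  rw [Nat.cast_div (orderOf_natCast_dvd_totient hcf) (Nat.cast_ne_zero.2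
    (orderOf_natCast_pos (Nat.pos_of_dvd_of_pos hf hN) hcf).ne'), Nat.totient_div_of_dvd hdN,
    Finset.sum_congr rfl (g := fun _ => (1 : ℚ) / orderOf (q : ZMod (N / d)))
      fun a ha => by rw [card_cyclotomicCoset hN h, (Finset.mem_filter.1 ha).2],
    Finset.sum_const, nsmul_eq_mul, mul_one_div]
end
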